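/- arXiv:2603.01219 — 10 statements merged into one kernel-verified Lean document; each statement's English description precedes it below -/
import Mathlib

section
/- Under the stated hypotheses, the Hodge homotopy d⁻ is graded self-adjoint with respect to the pairing: for all homogeneous x, y ∈ A one has ⟨d⁻x, y⟩ = (−1)^{|x|} ⟨x, d⁻y⟩. (Lemma 2.? (lem:adjoint), part (3).) -/
/-- Graded self-adjointness of the Hodge homotopy `d⁻`:
for homogeneous `x, y` one has `⟨d⁻x, y⟩ = (−1)^{|x|} ⟨x, d⁻y⟩`. -/
theorem stmt_0 {𝔽 A : Type*} [Field 𝔽] [CharZero 𝔽] [AddCommGroup A] [Module 𝔽 A]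
    (𝒜 : ℤ → Submodule 𝔽 A)
    (B : A →ₗ[𝔽] A →ₗ[𝔽] 𝔽)
    (hsymm : ∀ (i j : ℤ), ∀ x ∈ 𝒜 i, ∀ y ∈ 𝒜 j, B x y = (-1 : 𝔽) ^ (i * j) * B y x)
    (d dm : A →ₗ[𝔽] A)
    (hd_deg : ∀ (i : ℤ), ∀ x ∈ 𝒜 i, d x ∈ 𝒜 (i + 1))
    (hdd : d ∘ₗ d = 0)
    (hskew : ∀ (i j : ℤ), ∀ x ∈ 𝒜 i, ∀ y ∈ 𝒜 j, B (d x) y = -((-1 : 𝔽) ^ i) * B x (d y))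
    (hdm_deg : ∀ (i : ℤ), ∀ x ∈ 𝒜 i, dm x ∈ 𝒜 (i - 1))
    (hdmdm : dm ∘ₗ dm = 0)
    (h1 : dm ∘ₗ d ∘ₗ dm = dm)
    (h2 : d ∘ₗ dm ∘ₗ d = d)
    (horth1 : ∀ x y : A, B (dm x) (dm y) = 0)
    (horth2 : ∀ x y : A, B (((LinearMap.id - d ∘ₗ dm - dm ∘ₗ d : A →ₗ[𝔽] A)) x) (dm y) = 0) :
    ∀ (i j : ℤ), ∀ x ∈ 𝒜 i, ∀ y ∈ 𝒜 j, B (dm x) y = (-1 : 𝔽) ^ i * B x (dm y) := by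
  have decomp : ∀ x y : A, B x (dm y) = B (d (dm x)) (dm y) := fun x y => by
    have h := horth2 x y
    simp only [LinearMap.sub_apply, LinearMap.id_apply, LinearMap.comp_apply, map_sub,
      horth1, sub_zero] at h
    exact sub_eq_zero.mp h
  intro i j x hx y hy
  have hdmx := hdm_deg i x hx
  have hddmy : d (dm y) ∈ 𝒜 j := by
    simpa using hd_deg (j - 1) (dm y) (hdm_deg j y hy)
  have left : B (dm x) y = B (dm x) (d (dm y)) := by
    rw [hsymm (i - 1) j _ hdmx y hy, decomp y x, ← hsymm (i - 1) j _ hdmx _ hddmy]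
  have sign : (-1 : 𝔽) ^ i * (-1 : 𝔽) ^ i = 1 := by
    rw [← mul_zpow]; simp
  rw [left, decomp x y, hskew (i - 1) (j - 1) _ hdmx _ (hdm_deg j y hy),
    zpow_sub_one₀ (by simp)]
  linear_combination (-B (dm x) (d (dm y))) * sign +
    (-1 : 𝔽) ^ i * (-1 : 𝔽) ^ i * B (dm x) (d (dm y)) * (inv_neg_one : (-1 : 𝔽)⁻¹ = -1)
end

section
/- Under the stated hypotheses, A decomposes as the internal direct sum A = ℋ ⊕ Im(d∘d⁻) ⊕ Im(d⁻∘d); moreover d∘π = π∘d = 0, d⁻∘π = π∘d⁻ = 0, and every element of ℒ := Im(d∘d⁻) + Im(d⁻∘d) that is annihilated by d lies in d(ℒ) (i.e. the complex (ℒ, d) is acyclic). (Hodge decomposition, Remark rem:hodgedecomp.) -/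
/-- Hodge decomposition: `A = ℋ ⊕ Im(d∘d⁻) ⊕ Im(d⁻∘d)`, with `d∘π = π∘d = 0`,
`d⁻∘π = π∘d⁻ = 0`, and the complex `(ℒ, d)` acyclic, where
`π = id − d∘d⁻ − d⁻∘d`, `ℋ = Im π` and `ℒ = Im(d∘d⁻) + Im(d⁻∘d)`. -/
theorem stmt_2 {𝔽 A : Type*} [Field 𝔽] [AddCommGroup A] [Module 𝔽 A]
    (d dm : A →ₗ[𝔽] A)
    (hdd : d ∘ₗ d = 0) (hdmdm : dm ∘ₗ dm = 0)
    (h1 : dm ∘ₗ d ∘ₗ dm = dm) (h2 : d ∘ₗ dm ∘ₗ d = d) :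
    (∀ x : A, ∃ h ∈ LinearMap.range ((LinearMap.id - d ∘ₗ dm - dm ∘ₗ d : A →ₗ[𝔽] A)),
      ∃ a ∈ LinearMap.range (d ∘ₗ dm), ∃ b ∈ LinearMap.range (dm ∘ₗ d), x = h + a + b) ∧
    (∀ h ∈ LinearMap.range ((LinearMap.id - d ∘ₗ dm - dm ∘ₗ d : A →ₗ[𝔽] A)),
      ∀ a ∈ LinearMap.range (d ∘ₗ dm), ∀ b ∈ LinearMap.range (dm ∘ₗ d),
        h + a + b = 0 → h = 0 ∧ a = 0 ∧ b = 0) ∧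
    d ∘ₗ ((LinearMap.id - d ∘ₗ dm - dm ∘ₗ d : A →ₗ[𝔽] A)) = 0 ∧
    ((LinearMap.id - d ∘ₗ dm - dm ∘ₗ d : A →ₗ[𝔽] A)) ∘ₗ d = 0 ∧
    dm ∘ₗ ((LinearMap.id - d ∘ₗ dm - dm ∘ₗ d : A →ₗ[𝔽] A)) = 0 ∧
    ((LinearMap.id - d ∘ₗ dm - dm ∘ₗ d : A →ₗ[𝔽] A)) ∘ₗ dm = 0 ∧
    (∀ x ∈ (LinearMap.range (d ∘ₗ dm) ⊔ LinearMap.range (dm ∘ₗ d)), d x = 0 →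
      x ∈ Submodule.map d (LinearMap.range (d ∘ₗ dm) ⊔ LinearMap.range (dm ∘ₗ d))) := by
  have hd x : d (d x) = 0 := LinearMap.congr_fun hdd x
  have hdm x : dm (dm x) = 0 := LinearMap.congr_fun hdmdm x
  have hmdm x : dm (d (dm x)) = dm x := LinearMap.congr_fun h1 x
  have hdmd x : d (dm (d x)) = d x := LinearMap.congr_fun h2 x
  refine ⟨fun x => ⟨_, ⟨x, rfl⟩, _, ⟨x, rfl⟩, _, ⟨x, rfl⟩, by simp; abel⟩, ?_, ?_, ?_, ?_, ?_, ?_⟩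
  · rintro _ ⟨u, rfl⟩ _ ⟨v, rfl⟩ _ ⟨w, rfl⟩ h
    have hw : d w = 0 := by simpa [hd, hdmd] using congrArg d h
    have hv : dm v = 0 := by simpa [hdm, hmdm] using congrArg dm h
    simpa [hw, hv] using h
  · ext x; simp [hd, hdmd]
  · ext x; simp [hd, hdmd]
  · ext x; simp [hdm, hmdm]
  · ext x; simp [hdm, hmdm]
  · intro x hx hx0
    obtain ⟨_, ⟨u, rfl⟩, _, ⟨v, rfl⟩, rfl⟩ := Submodule.mem_sup.1 hx
    have hv : d v = 0 := by simpa [hd, hdmd] using hx0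
    exact ⟨dm (d (dm u)), Submodule.mem_sup_right ⟨dm u, rfl⟩, by simp [hv, hmdm]⟩
end

section
/- Generalized even symmetry for k = 3 (Lemma lem:evensymmetry3): for every homogeneous y of even degree and all homogeneous x, z one has m̂₃(x, y, z) = −(−1)^{|x||z|} m̂₃(z, y, x) and m̂₃(x, x, y) = −(−1)^{|x|} m̂₃(y, x, x); in particular, if x and y are both homogeneous of even degree then m̂₃(x, y, x) = 0. -/
/-- Generalized even symmetry for `k = 3`: with
`m̂₃(x, y, z) := d⁻(x·y)·z − (−1)^{|x|} x·d⁻(y·z)`, for homogeneous `y` of even degree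
and homogeneous `x, z` one has `m̂₃(x, y, z) = −(−1)^{|x||z|} m̂₃(z, y, x)` and
`m̂₃(x, x, y) = −(−1)^{|x|} m̂₃(y, x, x)`; in particular `m̂₃(x, y, x) = 0` if `x, y`
are both homogeneous of even degree. -/
theorem stmt_5 {𝔽 A : Type*} [Field 𝔽] [CharZero 𝔽] [Ring A] [Algebra 𝔽 A]
    (𝒜 : ℤ → Submodule 𝔽 A)
    (hcomm : ∀ (i j : ℤ), ∀ x ∈ 𝒜 i, ∀ y ∈ 𝒜 j, x * y = ((-1 : 𝔽) ^ (i * j)) • (y * x))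
    (hmul : ∀ (i j : ℤ), ∀ x ∈ 𝒜 i, ∀ y ∈ 𝒜 j, x * y ∈ 𝒜 (i + j))
    (dm : A →ₗ[𝔽] A)
    (hdm : ∀ (i : ℤ), ∀ x ∈ 𝒜 i, dm x ∈ 𝒜 (i - 1)) :
    (∀ (i j k : ℤ), ∀ x ∈ 𝒜 i, ∀ y ∈ 𝒜 j, Even j → ∀ z ∈ 𝒜 k,
      dm (x * y) * z - ((-1 : 𝔽) ^ i) • (x * dm (y * z)) =
        -(((-1 : 𝔽) ^ (i * k)) •
          (dm (z * y) * x - ((-1 : 𝔽) ^ k) • (z * dm (y * x))))) ∧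
    (∀ (i j : ℤ), ∀ x ∈ 𝒜 i, ∀ y ∈ 𝒜 j, Even j →
      dm (x * x) * y - ((-1 : 𝔽) ^ i) • (x * dm (x * y)) =
        -(((-1 : 𝔽) ^ i) •
          (dm (y * x) * x - ((-1 : 𝔽) ^ j) • (y * dm (x * x))))) ∧
    (∀ (i j : ℤ), ∀ x ∈ 𝒜 i, Even i → ∀ y ∈ 𝒜 j, Even j →
      dm (x * y) * x - ((-1 : 𝔽) ^ i) • (x * dm (y * x)) = 0) := by
  have heven_comm : ∀ (i j : ℤ), ∀ x ∈ 𝒜 i, ∀ y ∈ 𝒜 j, Even (i * j) → x * y = y * x := by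
    intro i j x hx y hy h
    rw [hcomm i j x hx y hy, h.neg_one_zpow, one_smul]
  have hodd_anticomm : ∀ (i j : ℤ), ∀ x ∈ 𝒜 i, ∀ y ∈ 𝒜 j, Odd (i * j) → x * y = -(y * x) := by
    intro i j x hx y hy h
    rw [hcomm i j x hx y hy, h.neg_one_zpow, neg_one_smul]
  have hdmul : ∀ (i j : ℤ), ∀ x ∈ 𝒜 i, ∀ y ∈ 𝒜 j, dm (x * y) ∈ 𝒜 (i + j - 1) :=
    fun i j x hx y hy => hdm _ _ (hmul i j x hx y hy)
  refine ⟨?_, ?_, ?_⟩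
  · intro i j k x hx y hy hj z hz
    rw [heven_comm j k y hy z hz (hj.mul_right k), heven_comm j i y hy x hx (hj.mul_right i)]
    have hxy := hdmul i j x hx y hy
    have hzy := hdmul k j z hz y hy
    rcases Int.even_or_odd i with hi | hi <;> rcases Int.even_or_odd k with hk | hk
    · rw [heven_comm _ _ _ hxy z hz (hk.mul_left _), heven_comm _ _ x hx _ hzy (hi.mul_right _),
        (hi.mul_right k).neg_one_zpow, hi.neg_one_zpow, hk.neg_one_zpow]
      simp only [one_smul]
      abel
    · rw [hodd_anticomm _ _ _ hxy z hz (((hi.add hj).sub_odd odd_one).mul hk),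
        heven_comm _ _ x hx _ hzy (hi.mul_right _),
        (hi.mul_right k).neg_one_zpow, hi.neg_one_zpow, hk.neg_one_zpow]
      simp only [one_smul, neg_one_smul]
      abel
    · rw [heven_comm _ _ _ hxy z hz (hk.mul_left _),
        hodd_anticomm _ _ x hx _ hzy (hi.mul ((hk.add hj).sub_odd odd_one)),
        (hk.mul_left i).neg_one_zpow, hi.neg_one_zpow, hk.neg_one_zpow]
      simp only [one_smul, neg_one_smul]
      abel
    · rw [heven_comm _ _ _ hxy z hz (((hi.add_even hj).sub_odd odd_one).mul_right _),
        heven_comm _ _ x hx _ hzy (((hk.add_even hj).sub_odd odd_one).mul_left _),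
        (hi.mul hk).neg_one_zpow, hi.neg_one_zpow, hk.neg_one_zpow]
      simp only [neg_one_smul]
      abel
  · intro i j x hx y hy hj
    have hxy := hdmul i j x hx y hy
    have hdeg : Even (i * (i + j - 1)) := (Int.even_or_odd i).elim (·.mul_right _)
      fun hi => ((hi.add_even hj).sub_odd odd_one).mul_left _
    rw [heven_comm j i y hy x hx (hj.mul_right i), hj.neg_one_zpow, one_smul,
      heven_comm _ _ x hx _ hxy hdeg]
    rcases Int.even_or_odd i with hi | hi
    · rw [heven_comm _ _ _ (hdmul i i x hx x hx) y hy (hj.mul_left _), hi.neg_one_zpow]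
      simp only [one_smul]
      abel
    · have hsq : x * x = 0 := by
        have h2 : (2 : 𝔽) • (x * x) = 0 := by
          rw [two_smul]
          exact eq_neg_iff_add_eq_zero.mp (hodd_anticomm i i x hx x hx (hi.mul hi))
        exact (smul_eq_zero.mp h2).resolve_left two_ne_zero
      simp [hsq, hi.neg_one_zpow]
  · intro i j x hx hi y hy hj
    rw [heven_comm i j x hx y hy (hi.mul_right j), hi.neg_one_zpow, one_smul,
      heven_comm _ _ x hx _ (hdmul j i y hy x hx) (hi.mul_right _), sub_self]
end

section
/- Generalized even symmetry for k = 4 (Lemma lem:evensymmetry4): for all x, y, z ∈ A^r one has m̂₄(x, x, x, y) = −m̂₄(y, x, x, x) and m̂₄(x, y, y, z) = −m̂₄(z, y, y, x). -/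
/-- The Merkulov trilinear construction specialized to inputs of even degree `r`:
`m̂₃(a, b, c) := d⁻(a·b)·c − a·d⁻(b·c)`. -/
def mhat3 {𝔽 A : Type*} [Field 𝔽] [Ring A] [Algebra 𝔽 A]
    (dm : A →ₗ[𝔽] A) (x y z : A) : A :=
  dm (x * y) * z - x * dm (y * z)

/-- The Merkulov quaternary construction specialized to inputs of even degree `r`:
`m̂₄(a, b, c, e) := −d⁻(m̂₃(a, b, c))·e − a·d⁻(m̂₃(b, c, e)) − d⁻(a·b)·d⁻(c·e)`. -/
def mhat4 {𝔽 A : Type*} [Field 𝔽] [Ring A] [Algebra 𝔽 A]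
    (dm : A →ₗ[𝔽] A) (a b c e : A) : A :=
  -(dm (mhat3 dm a b c) * e) - a * dm (mhat3 dm b c e) - dm (a * b) * dm (c * e)

section Reversal

variable {𝔽 A : Type*} [Field 𝔽] [Ring A] [Algebra 𝔽 A] {dm : A →ₗ[𝔽] A}

/-- Reversing the inputs of `m̂₃` changes its sign. -/
theorem mhat3_reverse {a b c : A} (hab : a * b = b * a) (hbc : b * c = c * b)
    (ha : a * dm (b * c) = dm (b * c) * a) (hc : c * dm (a * b) = dm (a * b) * c) :
    mhat3 dm c b a = -mhat3 dm a b c := by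
  simp only [mhat3, ← hab, ← hbc, ha, hc, neg_sub]

/-- Reversing the inputs of `m̂₄` changes its sign. -/
theorem mhat4_reverse {r : ℤ} (hr : Even r) {𝒜 : ℤ → Submodule 𝔽 A}
    (hcomm : ∀ (i j : ℤ), ∀ x ∈ 𝒜 i, ∀ y ∈ 𝒜 j, x * y = ((-1 : 𝔽) ^ (i * j)) • (y * x))
    (hmul : ∀ (i j : ℤ), ∀ x ∈ 𝒜 i, ∀ y ∈ 𝒜 j, x * y ∈ 𝒜 (i + j))
    (hdm : ∀ (i : ℤ), ∀ x ∈ 𝒜 i, dm x ∈ 𝒜 (i - 1))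
    {a b c e : A} (ha : a ∈ 𝒜 r) (hb : b ∈ 𝒜 r) (hc : c ∈ 𝒜 r) (he : e ∈ 𝒜 r) :
    mhat4 dm e c b a = -mhat4 dm a b c e := by
  have comm_of_mem {j : ℤ} {x y : A} (hx : x ∈ 𝒜 r) (hy : y ∈ 𝒜 j) : x * y = y * x := by
    rw [hcomm r j x hx y hy, (hr.mul_right j).neg_one_zpow, one_smul]
  have dm_mul_mem {x y : A} (hx : x ∈ 𝒜 r) (hy : y ∈ 𝒜 r) : dm (x * y) ∈ 𝒜 (r + r - 1) :=
    hdm _ _ (hmul _ _ _ hx _ hy)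
  have mhat3_mem {x y z : A} (hx : x ∈ 𝒜 r) (hy : y ∈ 𝒜 r) (hz : z ∈ 𝒜 r) :
      mhat3 dm x y z ∈ 𝒜 (r + (r + r - 1)) := by
    refine Submodule.sub_mem _ ?_ (hmul _ _ _ hx _ (dm_mul_mem hy hz))
    rw [← comm_of_mem hz (dm_mul_mem hx hy)]
    exact hmul _ _ _ hz _ (dm_mul_mem hx hy)
  have mhat3_rev {x y z : A} (hx : x ∈ 𝒜 r) (hy : y ∈ 𝒜 r) (hz : z ∈ 𝒜 r) :
      mhat3 dm z y x = -mhat3 dm x y z :=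
    mhat3_reverse (comm_of_mem hx hy) (comm_of_mem hy hz)
      (comm_of_mem hx (dm_mul_mem hy hz)) (comm_of_mem hz (dm_mul_mem hx hy))
  have odd_deg : Odd (r + r - 1) := (hr.add hr).sub_odd odd_one
  have anticomm : dm (c * e) * dm (a * b) = -(dm (a * b) * dm (c * e)) := by
    rw [hcomm _ _ _ (dm_mul_mem hc he) _ (dm_mul_mem ha hb),
      (odd_deg.mul odd_deg).neg_one_zpow, neg_one_smul]
  have comm_a := comm_of_mem ha (hdm _ _ (mhat3_mem hb hc he))
  have comm_e := comm_of_mem he (hdm _ _ (mhat3_mem ha hb hc))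
  simp only [mhat4, mhat3_rev hb hc he, mhat3_rev ha hb hc, comm_of_mem he hc,
    comm_of_mem hb ha, anticomm, map_neg, neg_mul, mul_neg, comm_a, comm_e]
  abel

end Reversal

/-- Generalized even symmetry for `k = 4`: for `x, y, z ∈ A^r`, `r` even positive,
`m̂₄(x, x, x, y) = −m̂₄(y, x, x, x)` and `m̂₄(x, y, y, z) = −m̂₄(z, y, y, x)`. -/
theorem stmt_6 {𝔽 A : Type*} [Field 𝔽] [CharZero 𝔽] [Ring A] [Algebra 𝔽 A]
    (r : ℤ) (hr_even : Even r) (hr_pos : 0 < r)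
    (𝒜 : ℤ → Submodule 𝔽 A)
    (hcomm : ∀ (i j : ℤ), ∀ x ∈ 𝒜 i, ∀ y ∈ 𝒜 j, x * y = ((-1 : 𝔽) ^ (i * j)) • (y * x))
    (hmul : ∀ (i j : ℤ), ∀ x ∈ 𝒜 i, ∀ y ∈ 𝒜 j, x * y ∈ 𝒜 (i + j))
    (dm : A →ₗ[𝔽] A)
    (hdm : ∀ (i : ℤ), ∀ x ∈ 𝒜 i, dm x ∈ 𝒜 (i - 1)) :
    ∀ x ∈ 𝒜 r, ∀ y ∈ 𝒜 r, ∀ z ∈ 𝒜 r,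
      mhat4 dm x x x y = -(mhat4 dm y x x x) ∧
      mhat4 dm x y y z = -(mhat4 dm z y y x) := by
  intro x hx y hy z hz
  have reverse {a b c e : A} (ha : a ∈ 𝒜 r) (hb : b ∈ 𝒜 r) (hc : c ∈ 𝒜 r) (he : e ∈ 𝒜 r) :=
    mhat4_reverse hr_even hcomm hmul hdm ha hb hc he
  exact ⟨reverse hy hx hx hx, reverse hz hy hy hx⟩
end

section
/- Generalized odd symmetry (Lemma lem:oddsymmetry): for every k ≥ 3 and all x, y, z ∈ A^r one has f_k(x, …, x, y) = (−1)^{k−1} f_k(y, x, …, x) and f_k(x, y, …, y, z) = (−1)^{k−1} f_k(z, y, …, y, x). -/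
/-- Powers of `-1` depend only on the parity of the exponent. -/
theorem neg_one_zpow_congr {K : Type*} [Field K] {a b : ℤ} (h : Even a ↔ Even b) :
    (-1 : K) ^ a = (-1) ^ b := by
  by_cases ha : Even a
  · rw [ha.neg_one_zpow, (h.1 ha).neg_one_zpow]
  · rw [(Int.not_even_iff_odd.1 ha).neg_one_zpow,
      (Int.not_even_iff_odd.1 (mt h.2 ha)).neg_one_zpow]

/-- Rescaling and swapping two anticommuting factors. -/
theorem smul_mul_smul_of_anticomm {K A : Type*} [Field K] [Ring A] [Algebra K A]
    {p q : A} (h : p * q = -(q * p)) (a b c : ℤ) :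
    (-1 : K) ^ a • (((-1 : K) ^ b • p) * ((-1 : K) ^ c • q)) =
      (-1 : K) ^ (a + b + c + 1) • (q * p) := by
  have h0 : (-1 : K) ≠ 0 := neg_ne_zero.2 one_ne_zero
  rw [smul_mul_smul_comm, h, smul_smul, zpow_add₀ h0, zpow_add₀ h0, zpow_add₀ h0, zpow_one,
    mul_neg_one, neg_smul, smul_neg, mul_assoc]

section MerkulovRecursion

variable {𝔽 A : Type*} [Field 𝔽] [Ring A] [Algebra 𝔽 A] {r : ℤ} {𝒜 : ℤ → Submodule 𝔽 A}
  {dm : A →ₗ[𝔽] A} {f : ℕ → (ℕ → A) → A}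

/-- The `k`-ary operation of the Merkulov recursion has degree `2 - k`. -/
theorem merkulov_mem
    (hmul : ∀ (i j : ℤ), ∀ x ∈ 𝒜 i, ∀ y ∈ 𝒜 j, x * y ∈ 𝒜 (i + j))
    (hdm : ∀ (i : ℤ), ∀ x ∈ 𝒜 i, dm x ∈ 𝒜 (i - 1))
    (hf2 : ∀ v : ℕ → A, (∀ t, v t ∈ 𝒜 r) → f 2 v = v 0 * v 1)
    (hrec : ∀ (k : ℕ), 3 ≤ k → ∀ v : ℕ → A, (∀ t, v t ∈ 𝒜 r) →
      f k v =
        ((-1 : 𝔽) ^ ((k : ℤ) - 1)) • (dm (f (k - 1) v) * v (k - 1))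
        - ((-1 : 𝔽) ^ ((k : ℤ) * r)) • (v 0 * dm (f (k - 1) (fun j => v (j + 1))))
        - ∑ i ∈ Finset.Icc 2 (k - 2),
            ((-1 : 𝔽) ^ ((i : ℤ) + ((k : ℤ) - (i : ℤ) - 1) * (i : ℤ) * r)) •
              (dm (f i v) * dm (f (k - i) (fun j => v (j + i)))))
    (k : ℕ) (hk : 2 ≤ k) (v : ℕ → A) (hv : ∀ t, v t ∈ 𝒜 r) :
    f k v ∈ 𝒜 (k * r - (k - 2)) := by
  induction k using Nat.strong_induction_on generalizing v with
  | _ k ih =>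
    obtain rfl | hk3 := hk.eq_or_lt
    · rw [hf2 v hv]
      convert hmul r r _ (hv 0) _ (hv 1) using 2
      push_cast
      ring
    have hd : ∀ i, 2 ≤ i → i < k → ∀ w : ℕ → A, (∀ t, w t ∈ 𝒜 r) →
        dm (f i w) ∈ 𝒜 (i * r - (i - 2) - 1) :=
      fun i h2 hi w hw => hdm _ _ (ih i hi h2 w hw)
    rw [hrec k hk3 v hv]
    refine Submodule.sub_mem _ (Submodule.sub_mem _ (Submodule.smul_mem _ _ ?_)
      (Submodule.smul_mem _ _ ?_))
      (Submodule.sum_mem _ fun i hi => Submodule.smul_mem _ _ ?_)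
    · convert hmul _ _ _ (hd (k - 1) (by omega) (by omega) v hv) _ (hv (k - 1)) using 2
      push_cast [Nat.cast_sub (show 1 ≤ k by omega)]
      ring
    · convert hmul _ _ _ (hv 0) _ (hd (k - 1) (by omega) (by omega) _ fun t => hv (t + 1)) using 2
      push_cast [Nat.cast_sub (show 1 ≤ k by omega)]
      ring
    · rw [Finset.mem_Icc] at hi
      convert hmul _ _ _ (hd i hi.1 (by omega) v hv) _
        (hd (k - i) (by omega) (by omega) _ fun t => hv (t + i)) using 2
      push_cast [Nat.cast_sub (show i ≤ k by omega)]
      ring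

/-- Reversing the arguments of the `k`-ary operation multiplies it by `(-1)^(k-1)` when the
arguments have odd degree. -/
theorem merkulov_reverse (hr_odd : Odd r)
    (hcomm : ∀ (i j : ℤ), ∀ x ∈ 𝒜 i, ∀ y ∈ 𝒜 j, x * y = ((-1 : 𝔽) ^ (i * j)) • (y * x))
    (hmul : ∀ (i j : ℤ), ∀ x ∈ 𝒜 i, ∀ y ∈ 𝒜 j, x * y ∈ 𝒜 (i + j))
    (hdm : ∀ (i : ℤ), ∀ x ∈ 𝒜 i, dm x ∈ 𝒜 (i - 1))
    (hf2 : ∀ v : ℕ → A, (∀ t, v t ∈ 𝒜 r) → f 2 v = v 0 * v 1)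
    (hrec : ∀ (k : ℕ), 3 ≤ k → ∀ v : ℕ → A, (∀ t, v t ∈ 𝒜 r) →
      f k v =
        ((-1 : 𝔽) ^ ((k : ℤ) - 1)) • (dm (f (k - 1) v) * v (k - 1))
        - ((-1 : 𝔽) ^ ((k : ℤ) * r)) • (v 0 * dm (f (k - 1) (fun j => v (j + 1))))
        - ∑ i ∈ Finset.Icc 2 (k - 2),
            ((-1 : 𝔽) ^ ((i : ℤ) + ((k : ℤ) - (i : ℤ) - 1) * (i : ℤ) * r)) •
              (dm (f i v) * dm (f (k - i) (fun j => v (j + i)))))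
    (k : ℕ) (hk : 2 ≤ k) (v w : ℕ → A) (hv : ∀ t, v t ∈ 𝒜 r) (hw : ∀ t, w t ∈ 𝒜 r)
    (hvw : ∀ j < k, w j = v (k - 1 - j)) :
    f k w = (-1 : 𝔽) ^ ((k : ℤ) - 1) • f k v := by
  have hanti : ∀ i j : ℤ, Odd i → Odd j → ∀ x ∈ 𝒜 i, ∀ y ∈ 𝒜 j, x * y = -(y * x) := by
    intro i j hi hj x hx y hy
    rw [hcomm i j x hx y hy, (hi.mul hj).neg_one_zpow, neg_one_smul]
  have hodd : ∀ i : ℕ, Odd ((i : ℤ) * r - (i - 2) - 1) := by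
    obtain ⟨m, rfl⟩ := hr_odd
    exact fun i => ⟨i * m, by ring⟩
  have hmem : ∀ i : ℕ, 2 ≤ i → ∀ u : ℕ → A, (∀ t, u t ∈ 𝒜 r) →
      dm (f i u) ∈ 𝒜 (i * r - (i - 2) - 1) :=
    fun i h2 u hu => hdm _ _ (merkulov_mem hmul hdm hf2 hrec i h2 u hu)
  have hr : ¬ Even r := Int.not_even_iff_odd.2 hr_odd
  induction k using Nat.strong_induction_on generalizing v w with
  | _ k ih =>
    obtain rfl | hk3 := hk.eq_or_lt
    · rw [hf2 v hv, hf2 w hw, hvw 0 (by omega), hvw 1 (by omega),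
        hanti r r hr_odd hr_odd _ (hv _) _ (hv _)]
      simp
    have hdih : ∀ i, 2 ≤ i → i < k → ∀ v w : ℕ → A, (∀ t, v t ∈ 𝒜 r) → (∀ t, w t ∈ 𝒜 r) →
        (∀ j < i, w j = v (i - 1 - j)) →
        dm (f i w) = (-1 : 𝔽) ^ ((i : ℤ) - 1) • dm (f i v) := by
      intro i h2 hi v w hv hw h
      rw [ih i hi h2 v w hv hw h, map_smul]
    have hlast : ((-1 : 𝔽) ^ ((k : ℤ) - 1)) • (dm (f (k - 1) w) * w (k - 1)) =
        -((-1 : 𝔽) ^ ((k : ℤ) - 1) •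
          ((-1 : 𝔽) ^ ((k : ℤ) * r)) • (v 0 * dm (f (k - 1) (fun j => v (j + 1))))) := by
      rw [hdih (k - 1) (by omega) (by omega) (fun j => v (j + 1)) w (fun _ => hv _) hw
          (fun j hj => by rw [hvw j (by omega)]; congr 1; omega),
        hvw (k - 1) (by omega), Nat.sub_self, smul_mul_assoc,
        hanti _ _ (hodd (k - 1)) hr_odd _ (hmem _ (by omega) _ fun _ => hv _) _ (hv 0),
        smul_neg, smul_neg, smul_smul, smul_smul, ← zpow_add₀ (neg_ne_zero.2 one_ne_zero),
        ← zpow_add₀ (neg_ne_zero.2 one_ne_zero)]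
      congr 2
      apply neg_one_zpow_congr
      push_cast [Nat.cast_sub (show 1 ≤ k by omega)]
      simp only [Int.even_add, Int.even_sub, Int.even_mul, hr, Int.not_even_one]
      by_cases h : Even (k : ℤ) <;> simp [h]
    have hfirst : ((-1 : 𝔽) ^ ((k : ℤ) * r)) • (w 0 * dm (f (k - 1) (fun j => w (j + 1)))) =
        -((-1 : 𝔽) ^ ((k : ℤ) - 1) •
          ((-1 : 𝔽) ^ ((k : ℤ) - 1)) • (dm (f (k - 1) v) * v (k - 1))) := by
      rw [hdih (k - 1) (by omega) (by omega) v (fun j => w (j + 1)) hv (fun _ => hw _)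
          (fun j hj => by rw [hvw (j + 1) (by omega)]; congr 1; omega),
        hvw 0 (by omega), Nat.sub_zero, mul_smul_comm,
        hanti _ _ hr_odd (hodd (k - 1)) _ (hv _) _ (hmem _ (by omega) _ hv),
        smul_neg, smul_neg, smul_smul, smul_smul, ← zpow_add₀ (neg_ne_zero.2 one_ne_zero),
        ← zpow_add₀ (neg_ne_zero.2 one_ne_zero)]
      congr 2
      apply neg_one_zpow_congr
      push_cast [Nat.cast_sub (show 1 ≤ k by omega)]
      simp only [Int.even_add, Int.even_sub, Int.even_mul, hr, Int.not_even_one]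
      by_cases h : Even (k : ℤ) <;> simp [h]
    rw [hrec k hk3 w hw, hrec k hk3 v hv, hlast, hfirst, smul_sub, smul_sub, sub_neg_eq_add,
      neg_add_eq_sub, Finset.smul_sum]
    congr 1
    refine Finset.sum_nbij' (fun i => k - i) (fun i => k - i) ?_ ?_ ?_ ?_ ?_
    any_goals
      intro i hi
      simp only [Finset.mem_Icc] at hi ⊢
      omega
    intro i hi
    rw [Finset.mem_Icc] at hi
    have hki : k - (k - i) = i := by omega
    rw [hki, hdih i hi.1 (by omega) (fun j => v (j + (k - i))) w (fun _ => hv _) hw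
        (fun j hj => by rw [hvw j (by omega)]; congr 1; omega),
      hdih (k - i) (by omega) (by omega) v (fun j => w (j + i)) hv (fun _ => hw _)
        (fun j hj => by rw [hvw (j + i) (by omega)]; congr 1; omega),
      smul_mul_smul_of_anticomm
        (hanti _ _ (hodd i) (hodd (k - i)) _ (hmem _ hi.1 _ fun _ => hv _) _
          (hmem _ (by omega) _ hv)),
      smul_smul, ← zpow_add₀ (neg_ne_zero.2 one_ne_zero)]
    congr 1
    apply neg_one_zpow_congr
    push_cast [Nat.cast_sub (show i ≤ k by omega)]
    simp only [Int.even_add, Int.even_sub, Int.even_mul, hr, Int.not_even_one]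
    by_cases h : Even (k : ℤ) <;> by_cases h' : Even (i : ℤ) <;> simp [h, h']

end MerkulovRecursion


/-- Generalized odd symmetry: for the family `f_k` satisfying the Merkulov recursion on
inputs of odd degree `r`, for every `k ≥ 3` and `x, y, z ∈ A^r` one has
`f_k(x, …, x, y) = (−1)^{k−1} f_k(y, x, …, x)` and
`f_k(x, y, …, y, z) = (−1)^{k−1} f_k(z, y, …, y, x)`.
Here `f k v` denotes the value of the `k`-multilinear map `f_k` on the tuple
`(v 0, …, v (k−1))`. -/
theorem stmt_7 {𝔽 A : Type*} [Field 𝔽] [CharZero 𝔽] [Ring A] [Algebra 𝔽 A]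
    (r : ℤ) (hr_odd : Odd r) (hr_pos : 0 < r)
    (𝒜 : ℤ → Submodule 𝔽 A)
    (hcomm : ∀ (i j : ℤ), ∀ x ∈ 𝒜 i, ∀ y ∈ 𝒜 j, x * y = ((-1 : 𝔽) ^ (i * j)) • (y * x))
    (hmul : ∀ (i j : ℤ), ∀ x ∈ 𝒜 i, ∀ y ∈ 𝒜 j, x * y ∈ 𝒜 (i + j))
    (dm : A →ₗ[𝔽] A)
    (hdm : ∀ (i : ℤ), ∀ x ∈ 𝒜 i, dm x ∈ 𝒜 (i - 1))
    (f : ℕ → (ℕ → A) → A)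
    -- `f_k` is multilinear in each of its `k` slots (on entries from `A^r`)
    (hlin : ∀ (k : ℕ), ∀ j < k, ∀ v : ℕ → A, (∀ t, v t ∈ 𝒜 r) →
      ∀ (c : 𝔽), ∀ x ∈ 𝒜 r, ∀ y ∈ 𝒜 r,
        f k (Function.update v j (c • x + y)) =
          c • f k (Function.update v j x) + f k (Function.update v j y))
    -- `f₂(a, b) = a·b`
    (hf2 : ∀ v : ℕ → A, (∀ t, v t ∈ 𝒜 r) → f 2 v = v 0 * v 1)
    -- the Merkulov recursion (eq:hat-mk) specialized to inputs of degree `r`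
    (hrec : ∀ (k : ℕ), 3 ≤ k → ∀ v : ℕ → A, (∀ t, v t ∈ 𝒜 r) →
      f k v =
        ((-1 : 𝔽) ^ ((k : ℤ) - 1)) • (dm (f (k - 1) v) * v (k - 1))
        - ((-1 : 𝔽) ^ ((k : ℤ) * r)) • (v 0 * dm (f (k - 1) (fun j => v (j + 1))))
        - ∑ i ∈ Finset.Icc 2 (k - 2),
            ((-1 : 𝔽) ^ ((i : ℤ) + ((k : ℤ) - (i : ℤ) - 1) * (i : ℤ) * r)) •
              (dm (f i v) * dm (f (k - i) (fun j => v (j + i)))))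
    -- the vanishing property `f_j(x, x, …, x) = 0` for `j ≥ 3`
    (hvanish : ∀ (j : ℕ), 3 ≤ j → ∀ x ∈ 𝒜 r, f j (fun _ => x) = 0) :
    ∀ (k : ℕ), 3 ≤ k → ∀ x ∈ 𝒜 r, ∀ y ∈ 𝒜 r, ∀ z ∈ 𝒜 r,
      (f k (fun j => if j = k - 1 then y else x) =
        ((-1 : 𝔽) ^ ((k : ℤ) - 1)) • f k (fun j => if j = 0 then y else x)) ∧
      (f k (fun j => if j = 0 then x else if j = k - 1 then z else y) =
        ((-1 : 𝔽) ^ ((k : ℤ) - 1)) •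
          f k (fun j => if j = 0 then z else if j = k - 1 then x else y)) := by
  intro k hk x hx y hy z hz
  have hrev := merkulov_reverse hr_odd hcomm hmul hdm hf2 hrec k (by omega)
  constructor
  · apply hrev
    · intro t; split_ifs <;> assumption
    · intro t; split_ifs <;> assumption
    · intro j hj
      have : k - 1 - j = 0 ↔ j = k - 1 := by omega
      simp only [this]
  · apply hrev
    · intro t; split_ifs <;> assumption
    · intro t; split_ifs <;> assumption
    · intro j hj
      split_ifs <;> first | rfl | omega
end

section
/- Algebraic Bianchi identity in dimension at most 3 (Lemma lem:ric (a), last assertion): let V be a finite-dimensional vector space over a field 𝔽 of characteristic zero with dim V ≤ 3, and let R : V × V × V × V → 𝔽 be a multilinear map which is antisymmetric in the first two arguments, antisymmetric in the last two arguments, and satisfies the pair-swapping symmetry R(x, y, z, w) = R(z, w, x, y). Then R satisfies the first Bianchi identity: R(x, y, z, w) + R(y, z, x, w) + R(z, x, y, w) = 0 for all x, y, z, w ∈ V. -/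
/-- The sum of a 4-form over the cyclic permutations of its first three arguments. -/
def bianchiSum {𝔽 V : Type*} [Field 𝔽] [AddCommGroup V] [Module 𝔽 V]
    (R : MultilinearMap 𝔽 (fun _ : Fin 4 => V) 𝔽) : MultilinearMap 𝔽 (fun _ : Fin 4 => V) 𝔽 :=
  R + R.domDomCongr (Equiv.swap 0 1 * Equiv.swap 1 2) +
    R.domDomCongr (Equiv.swap 1 2 * Equiv.swap 0 1)

theorem bianchiSum_apply {𝔽 V : Type*} [Field 𝔽] [AddCommGroup V] [Module 𝔽 V]
    (R : MultilinearMap 𝔽 (fun _ : Fin 4 => V) 𝔽) (v : Fin 4 → V) :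
    bianchiSum R v =
      R ![v 0, v 1, v 2, v 3] + R ![v 1, v 2, v 0, v 3] + R ![v 2, v 0, v 1, v 3] := by
  simp only [bianchiSum, add_apply, MultilinearMap.domDomCongr_apply]
  congr 3 <;> funext i <;> fin_cases i <;> rfl

/-- The Bianchi sum of a 4-form with the antisymmetries and pair symmetry of a curvature tensor
vanishes as soon as two arguments coincide. -/
theorem bianchi_sum_eq_zero_of_eq {𝔽 V : Type*} [Field 𝔽] [CharZero 𝔽]
    (f : V → V → V → V → 𝔽)
    (h12 : ∀ x y z w, f x y z w = -f y x z w)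
    (h34 : ∀ x y z w, f x y z w = -f x y w z)
    (hswap : ∀ x y z w, f x y z w = f z w x y)
    (x y z w : V) (h : x = y ∨ x = z ∨ x = w ∨ y = z ∨ y = w ∨ z = w) :
    f x y z w + f y z x w + f z x y w = 0 := by
  have h0 (a b c : V) : f a a b c = 0 := self_eq_neg.mp (h12 a a b c)
  have h0' (a b c : V) : f b c a a = 0 := self_eq_neg.mp (h34 b c a a)
  rcases h with rfl | rfl | rfl | rfl | rfl | rfl
  · linear_combination h0 x z w + h12 x z x w
  · linear_combination h0 x y w + h12 x y x w
  · linear_combination h0' x y z + h12 x y z x + hswap z x y x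
  · linear_combination h0 y x w + h12 x y y w
  · linear_combination h0' y z x + hswap x y z y + h12 z y x y
  · linear_combination h0' z x y + hswap y z x z + h12 x z y z

/-- Algebraic Bianchi identity in dimension at most 3: a multilinear 4-form that is
antisymmetric in the first two and in the last two arguments and has the pair-swapping
symmetry satisfies the first Bianchi identity. -/
theorem stmt_9 {𝔽 V : Type*} [Field 𝔽] [CharZero 𝔽] [AddCommGroup V] [Module 𝔽 V]
    [FiniteDimensional 𝔽 V] (hdim : Module.finrank 𝔽 V ≤ 3)
    (R : MultilinearMap 𝔽 (fun _ : Fin 4 => V) 𝔽)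
    (hanti12 : ∀ x y z w : V, R ![x, y, z, w] = -R ![y, x, z, w])
    (hanti34 : ∀ x y z w : V, R ![x, y, z, w] = -R ![x, y, w, z])
    (hswap : ∀ x y z w : V, R ![x, y, z, w] = R ![z, w, x, y]) :
    ∀ x y z w : V, R ![x, y, z, w] + R ![y, z, x, w] + R ![z, x, y, w] = 0 := by
  let B : V [⋀^Fin 4]→ₗ[𝔽] 𝔽 :=
    { bianchiSum R with
      map_eq_zero_of_eq' := fun v i j hv hij => by
        refine (bianchiSum_apply R v).trans <|
          bianchi_sum_eq_zero_of_eq (fun x y z w => R ![x, y, z, w])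
            hanti12 hanti34 hswap (v 0) (v 1) (v 2) (v 3) ?_
        fin_cases i <;> fin_cases j <;> first | exact absurd rfl hij | grind }
  intro x y z w
  refine (bianchiSum_apply R ![x, y, z, w]).symm.trans <|
    B.map_linearDependent ![x, y, z, w] fun h => ?_
  have := h.fintype_card_le_finrank
  rw [Fintype.card_fin] at this
  omega
end

section
/- The secondary obstruction cochain is a cocycle (Lemma lem:2obst): let 𝔽 be a field of characteristic zero, g an 𝔽-vector space with a bilinear bracket [−, −] : g × g → g and a linear map δ : g → g with δ∘δ = 0. Let m₃, m₄, m₄', φ₂ ∈ g and set m₃' := m₃ − δφ₂. Assume: δm₃ = 0; δm₄ = −(1/2)[m₃, m₃]; δm₄' = −(1/2)[m₃', m₃']; the symmetry [m₃, δφ₂] = [δφ₂, m₃]; and the Leibniz rule δ[φ₂, x] = [δφ₂, x] + [φ₂, δx] for all x ∈ g. Then the element κ̃₄ := m₄ − m₄' + [φ₂, m₃] − (1/2)[φ₂, δφ₂] satisfies δκ̃₄ = 0. If moreover [δφ₂, φ₂] = [φ₂, δφ₂], then 2[φ₂, δφ₂] = δ[φ₂, φ₂], so κ̃₄ differs from m₄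 − m₄' + [φ₂, m₃] by the coboundary −(1/4)δ[φ₂, φ₂]. -/
/-- The secondary obstruction cochain is a cocycle: with `m₃' := m₃ − δφ₂` and
`κ̃₄ := m₄ − m₄' + [φ₂, m₃] − (1/2)[φ₂, δφ₂]`, one has `δκ̃₄ = 0`; moreover if
`[δφ₂, φ₂] = [φ₂, δφ₂]` then `2[φ₂, δφ₂] = δ[φ₂, φ₂]`, so `κ̃₄` differs from
`m₄ − m₄' + [φ₂, m₃]` by the coboundary `−(1/4)δ[φ₂, φ₂]`. -/
theorem stmt_14 {𝔽 g : Type*} [Field 𝔽] [CharZero 𝔽] [AddCommGroup g] [Module 𝔽 g]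
    (br : g →ₗ[𝔽] g →ₗ[𝔽] g) (δ : g →ₗ[𝔽] g) (hδ : δ ∘ₗ δ = 0)
    (m3 m4 m4' φ2 : g)
    (hm3 : δ m3 = 0)
    (hm4 : δ m4 = -((1 / 2 : 𝔽) • br m3 m3))
    (hm4' : δ m4' = -((1 / 2 : 𝔽) • br (m3 - δ φ2) (m3 - δ φ2)))
    (hsym : br m3 (δ φ2) = br (δ φ2) m3)
    (hleib : ∀ x : g, δ (br φ2 x) = br (δ φ2) x + br φ2 (δ x)) :
    δ (m4 - m4' + br φ2 m3 - (1 / 2 : 𝔽) • br φ2 (δ φ2)) = 0 ∧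
    (br (δ φ2) φ2 = br φ2 (δ φ2) →
      ((2 : 𝔽) • br φ2 (δ φ2) = δ (br φ2 φ2) ∧
        m4 - m4' + br φ2 m3 - (1 / 2 : 𝔽) • br φ2 (δ φ2) =
          (m4 - m4' + br φ2 m3) - (1 / 4 : 𝔽) • δ (br φ2 φ2))) := by
  have hδδ : δ (δ φ2) = 0 := LinearMap.congr_fun hδ φ2
  refine ⟨?_, fun h => ?_⟩
  · simp only [map_sub, map_add, map_smul, hm4, hm4', hleib, hm3, hδδ, map_zero, add_zero,
      LinearMap.sub_apply, hsym]
    module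
  · rw [hleib, h]
    constructor <;> module
end

section
/- Vanishing of the transferred quaternary multiplication (key step of Proposition prop:m4 / Theorem thm:m4(1)): let 𝔽 be a field of characteristic zero and V an 𝔽-vector space of dimension at most 2. Let F : V⁵ → 𝔽 be a 5-multilinear form satisfying, for all vectors x, y, z, w, a, b, c, d, e ∈ V: (cyclicity) F(a, b, c, d, e) = F(b, c, d, e, a); (diagonal vanishing) F(x, x, x, x, w) = 0; (first symmetry) F(x, x, x, y, w) = −F(y, x, x, x, w); (second symmetry) F(x, y, y, z, w) = −F(z, y, y, x, w). Then F = 0. -/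
/-- A family indexed by at most two indices takes at most two values. -/
theorem exists_forall_eq_or_eq_of_le_two {V : Type*} [Inhabited V] {n : ℕ} (hn : n ≤ 2)
    (b : Fin n → V) : ∃ u v : V, ∀ i, b i = u ∨ b i = v := by
  interval_cases n
  · exact ⟨default, default, fun i => i.elim0⟩
  · exact ⟨b 0, b 0, fun i => Or.inl (congrArg b (Subsingleton.elim i 0))⟩
  · refine ⟨b 0, b 1, fun i => ?_⟩
    fin_cases i <;> simp


/-- Vanishing of the transferred quaternary multiplication: a 5-multilinear form `F` on
a vector space of dimension at most 2 over a field of characteristic zero which is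
cyclic, vanishes on `(x,x,x,x,w)`, and satisfies `F(x,x,x,y,w) = −F(y,x,x,x,w)` and
`F(x,y,y,z,w) = −F(z,y,y,x,w)`, is identically zero. -/
theorem stmt_17 {𝔽 V : Type*} [Field 𝔽] [CharZero 𝔽] [AddCommGroup V] [Module 𝔽 V]
    [FiniteDimensional 𝔽 V] (hdim : Module.finrank 𝔽 V ≤ 2)
    (F : MultilinearMap 𝔽 (fun _ : Fin 5 => V) 𝔽)
    (hcyc : ∀ a b c d e : V, F ![a, b, c, d, e] = F ![b, c, d, e, a])
    (hdiag : ∀ x w : V, F ![x, x, x, x, w] = 0)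
    (hsym1 : ∀ x y w : V, F ![x, x, x, y, w] = -F ![y, x, x, x, w])
    (hsym2 : ∀ x y z w : V, F ![x, y, y, z, w] = -F ![z, y, y, x, w]) :
    F = 0 := by
  have hpal : ∀ x y w : V, F ![x, y, y, x, w] = 0 := fun x y w =>
    self_eq_neg.mp (hsym2 x y x w)
  have : Inhabited V := ⟨0⟩
  let b := Module.finBasis 𝔽 V
  obtain ⟨u, v, huv⟩ := exists_forall_eq_or_eq_of_le_two hdim b
  have hword : ∀ f : Fin 5 → V, (∀ i, f i = u ∨ f i = v) → F f = 0 := by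
    intro f hf
    have hf_eq : f = ![f 0, f 1, f 2, f 3, f 4] := by
      ext i
      fin_cases i <;> rfl
    rw [hf_eq]
    rcases hf 0 with h0 | h0 <;> rcases hf 1 with h1 | h1 <;> rcases hf 2 with h2 | h2 <;>
      rcases hf 3 with h3 | h3 <;> rcases hf 4 with h4 | h4 <;>
      rw [h0, h1, h2, h3, h4] <;>
      first
        | exact hpal _ _ _
        | rw [hcyc]; exact hpal _ _ _
        | rw [hcyc, hcyc]; exact hpal _ _ _
        | rw [hcyc, hcyc, hcyc]; exact hpal _ _ _
        | rw [hcyc, hcyc, hcyc, hcyc]; exact hpal _ _ _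
  refine Module.Basis.ext_multilinear (fun _ => b) fun k => ?_
  exact hword _ fun i => huv (k i)
end

section
/- Harrison coboundary for m₃ in the case b^r = 2 (Proposition prop:coboundart-dim2): under the stated hypotheses, suppose there is s ∈ 𝔽 such that ⟨m₃(x, z, y), w⟩ = (s/2)(g(x, z)g(y, w) − g(x, w)g(y, z)) for all x, y, z, w ∈ H^r. Define the bilinear map p on homogeneous elements by: p(x, y) := −(s/4) g(x, y)·ϕ for x, y ∈ H^r; p(x, v) := −(s/4) ⟨v, ϕ⟩ x·ϕ for x ∈ H^r, v ∈ H^{2r}; p(v, y) := −(s/4) ⟨v, ϕ⟩ y·ϕ for v ∈ H^{2r}, y ∈ H^r; and p(a, b) := 0 for all other pairs of homogeneous degrees. Then p is a Harrison coboundary for m₃: for all homogeneous x, y, z ∈ H one has x·p(y, z) − p(x·y, z) + p(x, y·z) − p(x, y)·z = m₃(x, y, z). -/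
/-- In a graded algebra with nondegenerate trace form concentrated in degree `n`, a homogeneous
element that is orthogonal to the complementary degree vanishes. -/
theorem eq_zero_of_trace_mul_eq_zero {𝔽 H : Type*} [Field 𝔽] [Ring H] [Algebra 𝔽 H]
    {𝒜 : ℕ → Submodule 𝔽 H} (hsup : iSup 𝒜 = ⊤)
    (hmul : ∀ (i j : ℕ), ∀ x ∈ 𝒜 i, ∀ y ∈ 𝒜 j, x * y ∈ 𝒜 (i + j))
    {intg : H →ₗ[𝔽] 𝔽} {n : ℕ} (hint : ∀ i, i ≠ n → ∀ x ∈ 𝒜 i, intg x = 0)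
    (hnondeg : ∀ a : H, (∀ b : H, intg (a * b) = 0) → a = 0)
    {d : ℕ} {a : H} (ha : a ∈ 𝒜 d)
    (h : ∀ e, d + e = n → ∀ b ∈ 𝒜 e, intg (a * b) = 0) : a = 0 := by
  refine hnondeg a fun b => ?_
  have hb : b ∈ iSup 𝒜 := hsup ▸ Submodule.mem_top
  induction hb using Submodule.iSup_induction' with
  | mem e b hb =>
    by_cases he : d + e = n
    · exact h e he b hb
    · exact hint _ he _ (hmul _ _ _ ha _ hb)
  | zero => simp
  | add b b' _ _ hb hb' => rw [mul_add, map_add, hb, hb', add_zero]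


/-- Harrison coboundary for `m₃` in the case `b^r = 2` (Proposition prop:coboundart-dim2):
if `⟨m₃(x,z,y), w⟩ = (s/2)(g(x,z)g(y,w) − g(x,w)g(y,z))` on `H^r` and `p` is the bilinear
map defined piecewise by `p(x,y) = −(s/4) g(x,y)·ϕ` on `H^r × H^r`,
`p(x,v) = −(s/4)⟨v,ϕ⟩ x·ϕ` on `H^r × H^{2r}`, `p(v,y) = −(s/4)⟨v,ϕ⟩ y·ϕ` on
`H^{2r} × H^r`, and zero otherwise, then `δp = m₃` on homogeneous elements. -/
theorem stmt_18 {𝔽 H : Type*} [Field 𝔽] [CharZero 𝔽] [Ring H] [Algebra 𝔽 H]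
    (r : ℕ) (hr2 : 2 ≤ r) (hre : Even r)
    (𝒜 : ℕ → Submodule 𝔽 H)
    (hinternal : DirectSum.IsInternal 𝒜)
    (hone : (1 : H) ∈ 𝒜 0)
    (hdeg0 : 𝒜 0 = Submodule.span 𝔽 {(1 : H)})
    (hconn : ∀ i, 0 < i → i < r → 𝒜 i = ⊥)
    (htop : ∀ i, 4 * r - 1 < i → 𝒜 i = ⊥)
    (hmul : ∀ (i j : ℕ), ∀ x ∈ 𝒜 i, ∀ y ∈ 𝒜 j, x * y ∈ 𝒜 (i + j))
    (hcomm : ∀ (i j : ℕ), ∀ x ∈ 𝒜 i, ∀ y ∈ 𝒜 j, x * y = ((-1 : 𝔽) ^ (i * j)) • (y * x))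
    (intg : H →ₗ[𝔽] 𝔽)
    (hint : ∀ i, i ≠ 4 * r - 1 → ∀ x ∈ 𝒜 i, intg x = 0)
    (hnondeg : ∀ a : H, (∀ b : H, intg (a * b) = 0) → a = 0)
    (ϕ : H) (hϕ : ϕ ∈ 𝒜 (2 * r - 1))
    (hLef_inj : ∀ x ∈ 𝒜 r, ∀ x' ∈ 𝒜 r, ϕ * x = ϕ * x' → x = x')
    (hLef_surj : ∀ w ∈ 𝒜 (3 * r - 1), ∃ x ∈ 𝒜 r, ϕ * x = w)
    (m3 : H →ₗ[𝔽] H →ₗ[𝔽] H →ₗ[𝔽] H)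
    (hm3deg : ∀ x ∈ 𝒜 r, ∀ y ∈ 𝒜 r, ∀ z ∈ 𝒜 r, m3 x y z ∈ 𝒜 (3 * r - 1))
    (hm3van : ∀ (i j k : ℕ), ¬(i = r ∧ j = r ∧ k = r) →
      ∀ x ∈ 𝒜 i, ∀ y ∈ 𝒜 j, ∀ z ∈ 𝒜 k, m3 x y z = 0)
    (s : 𝔽)
    (hm3form : ∀ x ∈ 𝒜 r, ∀ y ∈ 𝒜 r, ∀ z ∈ 𝒜 r, ∀ w ∈ 𝒜 r,
      intg (m3 x z y * w) =
        s / 2 * (intg (ϕ * x * z) * intg (ϕ * y * w) - intg (ϕ * x * w) * intg (ϕ * y * z)))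
    (p : H →ₗ[𝔽] H →ₗ[𝔽] H)
    (hp_rr : ∀ x ∈ 𝒜 r, ∀ y ∈ 𝒜 r, p x y = (-(s / 4) * intg (ϕ * x * y)) • ϕ)
    (hp_r2r : ∀ x ∈ 𝒜 r, ∀ v ∈ 𝒜 (2 * r), p x v = (-(s / 4) * intg (v * ϕ)) • (x * ϕ))
    (hp_2rr : ∀ v ∈ 𝒜 (2 * r), ∀ y ∈ 𝒜 r, p v y = (-(s / 4) * intg (v * ϕ)) • (y * ϕ))
    (hp_else : ∀ (i j : ℕ),
      ¬((i = r ∧ j = r) ∨ (i = r ∧ j = 2 * r) ∨ (i = 2 * r ∧ j = r)) →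
      ∀ a ∈ 𝒜 i, ∀ b ∈ 𝒜 j, p a b = 0) :
    ∀ (i j k : ℕ), ∀ x ∈ 𝒜 i, ∀ y ∈ 𝒜 j, ∀ z ∈ 𝒜 k,
      x * p y z - p (x * y) z + p x (y * z) - p x y * z = m3 x y z := by
  have hdetect {d : ℕ} {a : H} (ha : a ∈ 𝒜 d)
      (h : ∀ e, d + e = 4 * r - 1 → ∀ b ∈ 𝒜 e, intg (a * b) = 0) : a = 0 :=
    eq_zero_of_trace_mul_eq_zero hinternal.submodule_iSup_eq_top hmul hint hnondeg ha h
  have hgap {d : ℕ} (hd : 3 * r - 1 < d) (hd' : d ≠ 4 * r - 1) {a : H} (ha : a ∈ 𝒜 d) :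
      a = 0 := by
    refine hdetect ha fun e he b hb => ?_
    rw [hconn e (by omega) (by omega), Submodule.mem_bot] at hb
    simp [hb]
  have hscalar {a : H} (ha : a ∈ 𝒜 0) : ∃ c : 𝔽, c • (1 : H) = a :=
    Submodule.mem_span_singleton.1 (hdeg0 ▸ ha)
  have htop_ext {a b : H} (ha : a ∈ 𝒜 (4 * r - 1)) (hb : b ∈ 𝒜 (4 * r - 1))
      (h : intg a = intg b) : a = b := by
    refine sub_eq_zero.1 (hdetect (sub_mem ha hb) fun e he u hu => ?_)
    obtain rfl : e = 0 := by omega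
    obtain ⟨c, rfl⟩ := hscalar hu
    simp [h]
  have hcentral {d j : ℕ} (hd : Even d) {a b : H} (ha : a ∈ 𝒜 d) (hb : b ∈ 𝒜 j) :
      a * b = b * a := by
    rw [hcomm d j a ha b hb, (hd.mul_right j).neg_one_pow, one_smul]
  have hre2 : Even (2 * r) := even_two_mul r
  have hpdeg (i j : ℕ) (a : H) (ha : a ∈ 𝒜 i) (b : H) (hb : b ∈ 𝒜 j) :
      p a b ∈ 𝒜 (i + j - 1) := by
    by_cases hij : (i = r ∧ j = r) ∨ (i = r ∧ j = 2 * r) ∨ (i = 2 * r ∧ j = r)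
    · rcases hij with ⟨hi, hj⟩ | ⟨hi, hj⟩ | ⟨hi, hj⟩ <;> subst i <;> subst j
      · rw [hp_rr a ha b hb, show r + r - 1 = 2 * r - 1 by omega]
        exact Submodule.smul_mem _ _ hϕ
      · rw [hp_r2r a ha b hb, show r + 2 * r - 1 = r + (2 * r - 1) by omega]
        exact Submodule.smul_mem _ _ (hmul _ _ _ ha _ hϕ)
      · rw [hp_2rr a ha b hb, show 2 * r + r - 1 = r + (2 * r - 1) by omega]
        exact Submodule.smul_mem _ _ (hmul _ _ _ hb _ hϕ)
    · rw [hp_else i j hij a ha b hb]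
      exact zero_mem _
  have hp_one_left {j : ℕ} {b : H} (hb : b ∈ 𝒜 j) : p 1 b = 0 :=
    hp_else 0 j (by omega) 1 hone b hb
  have hp_one_right {j : ℕ} {b : H} (hb : b ∈ 𝒜 j) : p b 1 = 0 :=
    hp_else j 0 (by omega) b hb 1 hone
  intro i j k x hx y hy z hz
  by_cases hi : i < r
  · rw [hm3van i j k (by omega) x hx y hy z hz]
    rcases Nat.eq_zero_or_pos i with rfl | hi0
    · obtain ⟨c, rfl⟩ := hscalar hx
      simp [hp_one_left hy, hp_one_left (hmul _ _ _ hy _ hz)]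
    · rw [hconn i hi0 hi, Submodule.mem_bot] at hx
      simp [hx]
  by_cases hj : j < r
  · rw [hm3van i j k (by omega) x hx y hy z hz]
    rcases Nat.eq_zero_or_pos j with rfl | hj0
    · obtain ⟨c, rfl⟩ := hscalar hy
      simp [hp_one_left hz, hp_one_right hx]
    · rw [hconn j hj0 hj, Submodule.mem_bot] at hy
      simp [hy]
  by_cases hk : k < r
  · rw [hm3van i j k (by omega) x hx y hy z hz]
    rcases Nat.eq_zero_or_pos k with rfl | hk0
    · obtain ⟨c, rfl⟩ := hscalar hz
      simp [hp_one_right hy, hp_one_right (hmul _ _ _ hx _ hy)]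
    · rw [hconn k hk0 hk, Submodule.mem_bot] at hz
      simp [hz]
  by_cases hijk : i = r ∧ j = r ∧ k = r
  · obtain ⟨hi, hj, hk⟩ := hijk
    subst i j k
    have hxy : x * y ∈ 𝒜 (2 * r) := two_mul r ▸ hmul _ _ _ hx _ hy
    have hyz : y * z ∈ 𝒜 (2 * r) := two_mul r ▸ hmul _ _ _ hy _ hz
    rw [hp_rr y hy z hz, hp_2rr _ hxy z hz, hp_r2r x hx _ hyz, hp_rr x hx y hy,
      hcentral hre2 hxy hϕ, hcentral hre2 hyz hϕ, mul_smul_comm, smul_mul_assoc,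
      hcentral hre hx hϕ, hcentral hre hz hϕ, ← mul_assoc ϕ x y, ← mul_assoc ϕ y z]
    have hdeg : r + (2 * r - 1) = 3 * r - 1 := by omega
    have hϕx : ϕ * x ∈ 𝒜 (3 * r - 1) := hdeg ▸ add_comm r _ ▸ hmul _ _ _ hϕ _ hx
    have hϕz : ϕ * z ∈ 𝒜 (3 * r - 1) := hdeg ▸ add_comm r _ ▸ hmul _ _ _ hϕ _ hz
    refine sub_eq_zero.1 (hdetect (d := 3 * r - 1) ?_ fun e he w hw => ?_)
    · exact sub_mem (sub_mem (add_mem (sub_mem (Submodule.smul_mem _ _ hϕx)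
        (Submodule.smul_mem _ _ hϕz)) (Submodule.smul_mem _ _ hϕx))
        (Submodule.smul_mem _ _ hϕz)) (hm3deg x hx y hy z hz)
    · obtain rfl : e = r := by omega
      have hsymm : ϕ * z * y = ϕ * y * z := by
        rw [mul_assoc, hcentral hre hz hy, mul_assoc]
      simp only [sub_mul, add_mul, smul_mul_assoc, map_sub, map_add, map_smul, smul_eq_mul,
        hm3form x hx z hz y hy w hw, hsymm]
      ring
  rw [hm3van i j k hijk x hx y hy z hz,
    hp_else (i + j) k (by omega) _ (hmul _ _ _ hx _ hy) z hz,
    hp_else i (j + k) (by omega) x hx _ (hmul _ _ _ hy _ hz), sub_zero, add_zero, sub_eq_zero]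
  have hl := hmul _ _ _ hx _ (hpdeg _ _ _ hy _ hz)
  have hr := hmul _ _ _ (hpdeg _ _ _ hx _ hy) _ hz
  by_cases hsum : i + j + k = 4 * r
  · rw [show i + (j + k - 1) = 4 * r - 1 by omega] at hl
    rw [show i + j - 1 + k = 4 * r - 1 by omega] at hr
    refine htop_ext hl hr ?_
    by_cases hjk : (j = r ∧ k = r) ∨ (j = r ∧ k = 2 * r) ∨ (j = 2 * r ∧ k = r)
    · rcases hjk with ⟨hj, hk⟩ | ⟨hj, hk⟩ | ⟨hj, hk⟩ <;> subst j k
      · obtain rfl : i = 2 * r := by omega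
        rw [hp_rr y hy z hz, hp_2rr x hx y hy, hcentral hre hy hϕ]
        simp only [mul_smul_comm, smul_mul_assoc, map_smul, smul_eq_mul]
        ring
      · obtain rfl : i = r := by omega
        rw [hp_r2r y hy z hz, hp_rr x hx y hy, hcentral hre2 hz hϕ, hcentral hre hy hϕ,
          mul_smul_comm, smul_mul_assoc, ← mul_assoc, hcentral hre hx hϕ]
        simp only [map_smul, smul_eq_mul]
        ring
      · obtain rfl : i = r := by omega
        rw [hp_2rr y hy z hz, hp_r2r x hx y hy, hcentral hre hz hϕ, mul_smul_comm,
          smul_mul_assoc, mul_assoc]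
    · rw [hp_else j k hjk y hy z hz, hp_else i j (by omega) x hx y hy, mul_zero, zero_mul]
  · rw [hgap (by omega) (by omega) hl, hgap (by omega) (by omega) hr]
end

section
/- Harrison coboundary for m₃ in the case b^r = 3 (Proposition prop:a3): under the stated hypotheses, suppose Ric is a symmetric bilinear form on H^r, η : H^r → H^r is a linear map with g(η(x), y) = Ric(x, y) for all x, y ∈ H^r, and s ∈ 𝔽, such that ⟨m₃(x, z, y), w⟩ = g(x, z)Ric(y, w) − g(x, w)Ric(y, z) + g(y, w)Ric(x, z) − g(y, z)Ric(x, w) − (s/2)(g(x, z)g(y, w) − g(x, w)g(y, z)) for all x, y, z, w ∈ H^r. Define the bilinear map p on homogeneous elements by: p(x, y) := ((s/4) g(x, y) − Ric(x, y))·ϕ for x, y ∈ H^r; p(x, v) := ⟨v, ϕ⟩ ((s/4) x − η(x))·ϕ for x ∈ H^r, v ∈ H^{2r}; p(v, y) := ⟨v, ϕ⟩ ((s/4) y − η(y))·ϕ for v ∈ H^{2r}, y ∈ H^r; and p(a, b) := 0 for all other pairs of homogeneous degrees. Then p is a Harrison coboundary for m₃: for all homogeneous x, y, z ∈ H one has x·p(y,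 z) − p(x·y, z) + p(x, y·z) − p(x, y)·z = m₃(x, y, z). -/
/-- In an internally graded algebra with a nondegenerate trace of degree `n`, a homogeneous element
of degree `m` is zero as soon as it pairs to zero with everything of complementary degree. -/
theorem eq_zero_of_forall_complementary {𝔽 H : Type*} [Field 𝔽] [Ring H] [Algebra 𝔽 H]
    {𝒜 : ℕ → Submodule 𝔽 H} (hinternal : DirectSum.IsInternal 𝒜)
    (hmul : ∀ (i j : ℕ), ∀ x ∈ 𝒜 i, ∀ y ∈ 𝒜 j, x * y ∈ 𝒜 (i + j))
    {intg : H →ₗ[𝔽] 𝔽} {n : ℕ} (hint : ∀ i, i ≠ n → ∀ x ∈ 𝒜 i, intg x = 0)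
    (hnondeg : ∀ a : H, (∀ b : H, intg (a * b) = 0) → a = 0)
    {m : ℕ} {a : H} (ha : a ∈ 𝒜 m)
    (h : ∀ k, m + k = n → ∀ w ∈ 𝒜 k, intg (a * w) = 0) : a = 0 := by
  refine hnondeg a fun b => ?_
  have hb : b ∈ ⨆ i, 𝒜 i := by simp [hinternal.submodule_iSup_eq_top]
  induction hb using Submodule.iSup_induction' with
  | mem k w hw =>
    by_cases hk : m + k = n
    · exact h k hk w hw
    · exact hint _ hk _ (hmul _ _ _ ha _ hw)
  | zero => simp
  | add u v _ _ hu hv => rw [mul_add, map_add, hu, hv, add_zero]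

/-- Graded commutativity is commutativity when one of the degrees is even. -/
theorem mul_comm_of_graded_of_even {𝔽 H : Type*} [Field 𝔽] [Ring H] [Algebra 𝔽 H]
    {𝒜 : ℕ → Submodule 𝔽 H}
    (hcomm : ∀ (i j : ℕ), ∀ x ∈ 𝒜 i, ∀ y ∈ 𝒜 j, x * y = ((-1 : 𝔽) ^ (i * j)) • (y * x))
    {i j : ℕ} (hi : Even i) {x y : H} (hx : x ∈ 𝒜 i) (hy : y ∈ 𝒜 j) : x * y = y * x := by
  rw [hcomm i j x hx y hy, (hi.mul_right j).neg_one_pow, one_smul]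

/-- Harrison coboundary for `m₃` in the case `b^r = 3` (Proposition prop:a3):
if `⟨m₃(x,z,y), w⟩ = g(x,z)Ric(y,w) − g(x,w)Ric(y,z) + g(y,w)Ric(x,z) − g(y,z)Ric(x,w)
− (s/2)(g(x,z)g(y,w) − g(x,w)g(y,z))` on `H^r`, with `Ric` symmetric and `η` the
`g`-adjoint of `Ric`, and `p` is the bilinear map defined piecewise by
`p(x,y) = ((s/4)g(x,y) − Ric(x,y))·ϕ` on `H^r × H^r`,
`p(x,v) = ⟨v,ϕ⟩((s/4)x − η(x))·ϕ` on `H^r × H^{2r}`,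
`p(v,y) = ⟨v,ϕ⟩((s/4)y − η(y))·ϕ` on `H^{2r} × H^r`, and zero otherwise, then
`δp = m₃` on homogeneous elements. -/
theorem stmt_19 {𝔽 H : Type*} [Field 𝔽] [CharZero 𝔽] [Ring H] [Algebra 𝔽 H]
    (r : ℕ) (hr2 : 2 ≤ r) (hre : Even r)
    (𝒜 : ℕ → Submodule 𝔽 H)
    (hinternal : DirectSum.IsInternal 𝒜)
    (hone : (1 : H) ∈ 𝒜 0)
    (hdeg0 : 𝒜 0 = Submodule.span 𝔽 {(1 : H)})
    (hconn : ∀ i, 0 < i → i < r → 𝒜 i = ⊥)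
    (htop : ∀ i, 4 * r - 1 < i → 𝒜 i = ⊥)
    (hmul : ∀ (i j : ℕ), ∀ x ∈ 𝒜 i, ∀ y ∈ 𝒜 j, x * y ∈ 𝒜 (i + j))
    (hcomm : ∀ (i j : ℕ), ∀ x ∈ 𝒜 i, ∀ y ∈ 𝒜 j, x * y = ((-1 : 𝔽) ^ (i * j)) • (y * x))
    (intg : H →ₗ[𝔽] 𝔽)
    (hint : ∀ i, i ≠ 4 * r - 1 → ∀ x ∈ 𝒜 i, intg x = 0)
    (hnondeg : ∀ a : H, (∀ b : H, intg (a * b) = 0) → a = 0)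
    (ϕ : H) (hϕ : ϕ ∈ 𝒜 (2 * r - 1))
    (hLef_inj : ∀ x ∈ 𝒜 r, ∀ x' ∈ 𝒜 r, ϕ * x = ϕ * x' → x = x')
    (hLef_surj : ∀ w ∈ 𝒜 (3 * r - 1), ∃ x ∈ 𝒜 r, ϕ * x = w)
    (m3 : H →ₗ[𝔽] H →ₗ[𝔽] H →ₗ[𝔽] H)
    (hm3deg : ∀ x ∈ 𝒜 r, ∀ y ∈ 𝒜 r, ∀ z ∈ 𝒜 r, m3 x y z ∈ 𝒜 (3 * r - 1))
    (hm3van : ∀ (i j k : ℕ), ¬(i = r ∧ j = r ∧ k = r) →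
      ∀ x ∈ 𝒜 i, ∀ y ∈ 𝒜 j, ∀ z ∈ 𝒜 k, m3 x y z = 0)
    (Ric : H →ₗ[𝔽] H →ₗ[𝔽] 𝔽)
    (hRicSymm : ∀ x ∈ 𝒜 r, ∀ y ∈ 𝒜 r, Ric x y = Ric y x)
    (eta : H →ₗ[𝔽] H)
    (heta_mem : ∀ x ∈ 𝒜 r, eta x ∈ 𝒜 r)
    (heta : ∀ x ∈ 𝒜 r, ∀ y ∈ 𝒜 r, intg (ϕ * eta x * y) = Ric x y)
    (s : 𝔽)
    (hm3form : ∀ x ∈ 𝒜 r, ∀ y ∈ 𝒜 r, ∀ z ∈ 𝒜 r, ∀ w ∈ 𝒜 r,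
      intg (m3 x z y * w) =
        intg (ϕ * x * z) * Ric y w - intg (ϕ * x * w) * Ric y z
          + intg (ϕ * y * w) * Ric x z - intg (ϕ * y * z) * Ric x w
          - s / 2 * (intg (ϕ * x * z) * intg (ϕ * y * w)
              - intg (ϕ * x * w) * intg (ϕ * y * z)))
    (p : H →ₗ[𝔽] H →ₗ[𝔽] H)
    (hp_rr : ∀ x ∈ 𝒜 r, ∀ y ∈ 𝒜 r,
      p x y = (s / 4 * intg (ϕ * x * y) - Ric x y) • ϕ)
    (hp_r2r : ∀ x ∈ 𝒜 r, ∀ v ∈ 𝒜 (2 * r),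
      p x v = intg (v * ϕ) • (((s / 4) • x - eta x) * ϕ))
    (hp_2rr : ∀ v ∈ 𝒜 (2 * r), ∀ y ∈ 𝒜 r,
      p v y = intg (v * ϕ) • (((s / 4) • y - eta y) * ϕ))
    (hp_else : ∀ (i j : ℕ),
      ¬((i = r ∧ j = r) ∨ (i = r ∧ j = 2 * r) ∨ (i = 2 * r ∧ j = r)) →
      ∀ a ∈ 𝒜 i, ∀ b ∈ 𝒜 j, p a b = 0) :
    ∀ (i j k : ℕ), ∀ x ∈ 𝒜 i, ∀ y ∈ 𝒜 j, ∀ z ∈ 𝒜 k,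
      x * p y z - p (x * y) z + p x (y * z) - p x y * z = m3 x y z := by
  have hext {m : ℕ} {a : H} (ha : a ∈ 𝒜 m)
      (h : ∀ k, m + k = 4 * r - 1 → ∀ w ∈ 𝒜 k, intg (a * w) = 0) : a = 0 :=
    eq_zero_of_forall_complementary hinternal hmul hint hnondeg ha h
  have hscalar {x : H} (hx : x ∈ 𝒜 0) : ∃ c : 𝔽, c • (1 : H) = x :=
    Submodule.mem_span_singleton.1 (hdeg0 ▸ hx)
  have hgap {m : ℕ} (h₁ : 3 * r - 1 < m) (h₂ : m ≠ 4 * r - 1) {a : H} (ha : a ∈ 𝒜 m) :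
      a = 0 := by
    refine hext ha fun k hk w hw => ?_
    rw [hconn k (by omega) (by omega), Submodule.mem_bot] at hw
    simp [hw]
  have htop_ext {a b : H} (ha : a ∈ 𝒜 (4 * r - 1)) (hb : b ∈ 𝒜 (4 * r - 1))
      (h : intg a = intg b) : a = b := by
    refine sub_eq_zero.1 (hext (sub_mem ha hb) fun k hk w hw => ?_)
    obtain rfl : k = 0 := by omega
    obtain ⟨c, rfl⟩ := hscalar hw
    simp [h]
  have hr_even : Even (2 * r) := even_two_mul r
  have hcr {x : H} (hx : x ∈ 𝒜 r) : x * ϕ = ϕ * x :=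
    mul_comm_of_graded_of_even hcomm hre hx hϕ
  have hc2r {v : H} (hv : v ∈ 𝒜 (2 * r)) : v * ϕ = ϕ * v :=
    mul_comm_of_graded_of_even hcomm hr_even hv hϕ
  have hgsymm {x y : H} (hx : x ∈ 𝒜 r) (hy : y ∈ 𝒜 r) :
      intg (ϕ * x * y) = intg (ϕ * y * x) := by
    rw [mul_assoc, mul_comm_of_graded_of_even hcomm hre hx hy, mul_assoc]
  -- the operator `s/4 - η` and the form it represents
  have hT_mem {x : H} (hx : x ∈ 𝒜 r) : (s / 4) • x - eta x ∈ 𝒜 r :=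
    sub_mem (Submodule.smul_mem _ _ hx) (heta_mem x hx)
  have hT {x y : H} (hx : x ∈ 𝒜 r) (hy : y ∈ 𝒜 r) :
      intg (((s / 4) • x - eta x) * ϕ * y) = s / 4 * intg (ϕ * x * y) - Ric x y := by
    rw [hcr (hT_mem hx), mul_sub, sub_mul, map_sub, heta x hx y hy]
    simp
  have hT' {x y : H} (hx : x ∈ 𝒜 r) (hy : y ∈ 𝒜 r) :
      intg (x * (((s / 4) • y - eta y) * ϕ)) = s / 4 * intg (ϕ * x * y) - Ric x y := by
    rw [mul_comm_of_graded_of_even hcomm hre hx (hmul _ _ _ (hT_mem hy) _ hϕ), hT hy hx,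
      hgsymm hx hy, hRicSymm x hx y hy]
  have hp_r2r_mem {x v : H} (hx : x ∈ 𝒜 r) (hv : v ∈ 𝒜 (2 * r)) : p x v ∈ 𝒜 (3 * r - 1) := by
    rw [hp_r2r x hx v hv, show 3 * r - 1 = r + (2 * r - 1) by omega]
    exact Submodule.smul_mem _ _ (hmul _ _ _ (hT_mem hx) _ hϕ)
  have hp_2rr_mem {v y : H} (hv : v ∈ 𝒜 (2 * r)) (hy : y ∈ 𝒜 r) : p v y ∈ 𝒜 (3 * r - 1) := by
    rw [hp_2rr v hv y hy, show 3 * r - 1 = r + (2 * r - 1) by omega]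
    exact Submodule.smul_mem _ _ (hmul _ _ _ (hT_mem hy) _ hϕ)
  have hp_rr_mem {x y : H} (hx : x ∈ 𝒜 r) (hy : y ∈ 𝒜 r) : p x y ∈ 𝒜 (2 * r - 1) := by
    rw [hp_rr x hx y hy]
    exact Submodule.smul_mem _ _ hϕ
  have hmul_mem {a b d : ℕ} (h : a + b = d) {x y : H} (hx : x ∈ 𝒜 a) (hy : y ∈ 𝒜 b) :
      x * y ∈ 𝒜 d := h ▸ hmul _ _ _ hx _ hy
  have hone_left {k : ℕ} {z : H} (hz : z ∈ 𝒜 k) : p 1 z = 0 :=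
    hp_else 0 k (by omega) 1 hone z hz
  have hone_right {k : ℕ} {z : H} (hz : z ∈ 𝒜 k) : p z 1 = 0 :=
    hp_else k 0 (by omega) z hz 1 hone
  have hrange {i : ℕ} {x : H} (hx : x ∈ 𝒜 i) : i = 0 ∨ x = 0 ∨ r ≤ i := by
    by_cases hi : 0 < i ∧ i < r
    · rw [hconn i hi.1 hi.2, Submodule.mem_bot] at hx
      exact Or.inr (Or.inl hx)
    · omega
  intro i j k x hx y hy z hz
  rcases hrange hx with rfl | rfl | hi
  · obtain ⟨c, rfl⟩ := hscalar hx
    rw [hm3van 0 j k (by omega) _ hx y hy z hz]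
    simp [hone_left hy, hone_left (hmul _ _ _ hy _ hz)]
  · simp
  rcases hrange hy with rfl | rfl | hj
  · obtain ⟨c, rfl⟩ := hscalar hy
    rw [hm3van i 0 k (by omega) x hx _ hy z hz]
    simp [hone_left hz, hone_right hx]
  · simp
  rcases hrange hz with rfl | rfl | hk
  · obtain ⟨c, rfl⟩ := hscalar hz
    rw [hm3van i j 0 (by omega) x hx y hy _ hz]
    simp [hone_right hy, hone_right (hmul _ _ _ hx _ hy)]
  · simp
  by_cases hrrr : i = r ∧ j = r ∧ k = r
  · obtain ⟨rfl, rfl, rfl⟩ := hrrr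
    have hxy : x * y ∈ 𝒜 (2 * k) := hmul_mem (by omega) hx hy
    have hyz : y * z ∈ 𝒜 (2 * k) := hmul_mem (by omega) hy hz
    refine sub_eq_zero.1 (hext (m := 3 * k - 1) ?_ fun d hd w hw => ?_)
    · exact sub_mem (sub_mem (add_mem (sub_mem (hmul_mem (by omega) hx (hp_rr_mem hy hz))
        (hp_2rr_mem hxy hz)) (hp_r2r_mem hx hyz)) (hmul_mem (by omega) (hp_rr_mem hx hy) hz))
        (hm3deg x hx y hy z hz)
    · obtain rfl : d = k := by omega
      have h₁ : intg (x * p y z * w) =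
          (s / 4 * intg (ϕ * y * z) - Ric y z) * intg (ϕ * x * w) := by
        rw [hp_rr y hy z hz, mul_smul_comm, hcr hx, smul_mul_assoc, map_smul, smul_eq_mul]
      have h₂ : intg (p (x * y) z * w) =
          intg (ϕ * x * y) * (s / 4 * intg (ϕ * z * w) - Ric z w) := by
        rw [hp_2rr _ hxy z hz, smul_mul_assoc, map_smul, hT hz hw, hc2r hxy, smul_eq_mul,
          mul_assoc ϕ x y]
      have h₃ : intg (p x (y * z) * w) =
          intg (ϕ * y * z) * (s / 4 * intg (ϕ * x * w) - Ric x w) := by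
        rw [hp_r2r x hx _ hyz, smul_mul_assoc, map_smul, hT hx hw, hc2r hyz, smul_eq_mul,
          mul_assoc ϕ y z]
      have h₄ : intg (p x y * z * w) =
          (s / 4 * intg (ϕ * x * y) - Ric x y) * intg (ϕ * z * w) := by
        rw [hp_rr x hx y hy, smul_mul_assoc, smul_mul_assoc, map_smul, smul_eq_mul]
      rw [sub_mul, sub_mul, add_mul, sub_mul, map_sub, map_sub, map_add, map_sub, h₁, h₂, h₃, h₄,
        hm3form x hx z hz y hy w hw, hRicSymm z hz y hy, hgsymm hz hy]
      ring
  rw [hm3van i j k hrrr x hx y hy z hz, hp_else (i + j) k (by omega) _ (hmul _ _ _ hx _ hy) z hz,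
    hp_else i (j + k) (by omega) x hx _ (hmul _ _ _ hy _ hz), sub_zero, add_zero, sub_eq_zero]
  -- the outer products vanish by degree unless `i + j + k = 4 * r`
  have hleft (h : i + j + k ≠ 4 * r) : x * p y z = 0 := by
    by_cases hjk : (j = r ∧ k = r) ∨ (j = r ∧ k = 2 * r) ∨ (j = 2 * r ∧ k = r)
    · rcases hjk with ⟨rfl, rfl⟩ | ⟨rfl, rfl⟩ | ⟨rfl, rfl⟩
      · exact hgap (by omega) (by omega) (hmul _ _ _ hx _ (hp_rr_mem hy hz))
      · exact hgap (by omega) (by omega) (hmul _ _ _ hx _ (hp_r2r_mem hy hz))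
      · exact hgap (by omega) (by omega) (hmul _ _ _ hx _ (hp_2rr_mem hy hz))
    · rw [hp_else j k hjk y hy z hz, mul_zero]
  have hright (h : i + j + k ≠ 4 * r) : p x y * z = 0 := by
    by_cases hij : (i = r ∧ j = r) ∨ (i = r ∧ j = 2 * r) ∨ (i = 2 * r ∧ j = r)
    · rcases hij with ⟨rfl, rfl⟩ | ⟨rfl, rfl⟩ | ⟨rfl, rfl⟩
      · exact hgap (by omega) (by omega) (hmul _ _ _ (hp_rr_mem hx hy) _ hz)
      · exact hgap (by omega) (by omega) (hmul _ _ _ (hp_r2r_mem hx hy) _ hz)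
      · exact hgap (by omega) (by omega) (hmul _ _ _ (hp_2rr_mem hx hy) _ hz)
    · rw [hp_else i j hij x hx y hy, zero_mul]
  by_cases hsum : i + j + k = 4 * r
  swap
  · rw [hleft hsum, hright hsum]
  by_cases hi2 : i = 2 * r
  · obtain ⟨rfl, rfl, rfl⟩ : i = 2 * r ∧ j = r ∧ k = r := by omega
    refine htop_ext (hmul_mem (by omega) hx (hp_rr_mem hy hz))
      (hmul_mem (by omega) (hp_2rr_mem hx hy) hz) ?_
    rw [hp_rr y hy z hz, hp_2rr x hx y hy, mul_smul_comm, smul_mul_assoc, map_smul, map_smul,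
      hT hy hz, smul_eq_mul, smul_eq_mul, mul_comm]
  by_cases hj2 : j = 2 * r
  · obtain ⟨rfl, rfl, rfl⟩ : i = r ∧ j = 2 * r ∧ k = r := by omega
    refine htop_ext (hmul_mem (by omega) hx (hp_2rr_mem hy hz))
      (hmul_mem (by omega) (hp_r2r_mem hx hy) hz) ?_
    rw [hp_2rr y hy z hz, hp_r2r x hx y hy, mul_smul_comm, smul_mul_assoc, map_smul, map_smul,
      hT hx hz, hT' hx hz]
  by_cases hk2 : k = 2 * r
  · obtain ⟨rfl, rfl, rfl⟩ : i = r ∧ j = r ∧ k = 2 * r := by omega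
    refine htop_ext (hmul_mem (by omega) hx (hp_r2r_mem hy hz))
      (hmul_mem (by omega) (hp_rr_mem hx hy) hz) ?_
    rw [hp_rr x hx y hy, hp_r2r y hy z hz, mul_smul_comm, smul_mul_assoc, map_smul, map_smul,
      hT' hx hy, hc2r hz, smul_eq_mul, smul_eq_mul, mul_comm]
  rw [hp_else j k (by omega) y hy z hz, hp_else i j (by omega) x hx y hy, mul_zero, zero_mul]
end
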